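/- Every 2-dimensional face of a d-braxtope Q^{d,n} (n ≥ d ≥ 3) is a triangle. -/

import Mathlib

open Set

noncomputable section

variable {V : Type*} [NormedAddCommGroup V] [NormedSpace ℝ V]

open Classical in
/-- Affine dimension of a set: `-1` for the empty set, otherwise the
dimension of its affine hull. -/
def sdim (s : Set V) : ℤ :=
  if s.Nonempty then (Module.finrank ℝ (affineSpan ℝ s).direction : ℤ) else -1

/-- `F` is a face of the polytope `Q`. -/
def IsFaceOf (Q F : Set V) : Prop :=
  IsExtreme ℝ Q F ∧ Convex ℝ F ∧ IsClosed F

/-- `F` is a facet of the `d`-polytope `Q`. -/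
def IsFacetOf (d : ℕ) (Q F : Set V) : Prop :=
  IsFaceOf Q F ∧ sdim F = (d : ℤ) - 1

/-- The segment `[a, b]` is an edge (a 1-dimensional face) of `Q`. -/
def IsEdgeOf (Q : Set V) (a b : V) : Prop :=
  IsFaceOf Q (segment ℝ a b) ∧ sdim (segment ℝ a b) = 1

/-- Clamped vertex indexing: `x_t = x_0` for `t ≤ 0` and `x_t = x_n` for `t ≥ n`. -/
def xc {n : ℕ} (x : Fin (n + 1) → V) (t : ℤ) : V :=
  x ⟨(min (max t 0) n).toNat, by omega⟩

/-- The polytope spanned by the vertex array `x`. -/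
def braxQ {n : ℕ} (x : Fin (n + 1) → V) : Set V :=
  convexHull ℝ (Set.range x)

/-- Vertex set of the simplex facet `T_i = [x_i, …, x_{i+d-1}]`. -/
def Tset (d : ℕ) {n : ℕ} (x : Fin (n + 1) → V) (i : ℤ) : Set V :=
  xc x '' Set.Icc i (i + (d : ℤ) - 1)

/-- Vertex set of the facet
`E_j = [x_0, x_{j-(d-2)}, …, x_{j-1}, x_{j+1}, …, x_{j+(d-2)}]`. -/
def Eset (d : ℕ) {n : ℕ} (x : Fin (n + 1) → V) (j : ℤ) : Set V :=
  insert (x 0) (xc x '' (Set.Icc (j - ((d : ℤ) - 2)) (j + ((d : ℤ) - 2)) \ {j}))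

/-- `x_0 < x_1 < ⋯ < x_n` is the vertex array of a `d`-braxtope: for `d ≤ 2` a
`d`-simplex; for `d ≥ 3` a `d`-polytope whose facets are exactly the `T_i`
(`0 ≤ i ≤ n - d + 1`) and the `E_j` (`2 ≤ j ≤ n`). -/
def IsBraxtope (d n : ℕ) (x : Fin (n + 1) → V) : Prop :=
  (d ≤ 2 → n = d ∧ AffineIndependent ℝ x) ∧
  (3 ≤ d →
    d ≤ n ∧ Function.Injective x ∧
    sdim (braxQ x) = d ∧
    (∀ i, x i ∈ Set.extremePoints ℝ (braxQ x)) ∧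
    (∀ F : Set V, IsFacetOf d (braxQ x) F ↔
      (∃ i : ℤ, 0 ≤ i ∧ i ≤ (n : ℤ) - d + 1 ∧ F = convexHull ℝ (Tset d x i)) ∨
      (∃ j : ℤ, 2 ≤ j ∧ j ≤ (n : ℤ) ∧ F = convexHull ℝ (Eset d x j))))
theorem farkas_aux {ι : Type*} [DecidableEq ι] {V : Type*} [AddCommGroup V] [Module ℝ V] (s : Finset ι) :
    ∀ (v : ι → V) (b : V), (¬ ∃ c : ι → ℝ, (∀ i, 0 ≤ c i) ∧ b = ∑ i ∈ s, c i • v i) →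
      ∃ f : V →ₗ[ℝ] ℝ, (∀ i ∈ s, 0 ≤ f (v i)) ∧ f b < 0 := by
  induction s using Finset.induction_on with
  | empty =>
    intro v b h
    have hb : b ≠ 0 := fun hb => h ⟨0, by simp, by simp [hb]⟩
    obtain ⟨f, hf, -⟩ := Submodule.exists_le_ker_of_notMem (K := ℝ) (p := ⊥) (v := b) (by simpa using hb)
    rcases lt_or_gt_of_ne hf with h | h
    · exact ⟨f, by simp, h⟩
    · exact ⟨-f, by simp, by simpa using h⟩
  | insert a s ha ih =>
    intro v b h
    have h1 : ¬ ∃ c : ι → ℝ, (∀ i, 0 ≤ c i) ∧ b = ∑ i ∈ s, c i • v i := by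
      rintro ⟨c, hc, hb⟩
      refine h ⟨Function.update c a 0, fun i => ?_, ?_⟩
      · by_cases hi : i = a
        · subst hi; simp
        · simp [hi, hc]
      · rw [Finset.sum_insert ha, hb]
        simp only [Function.update_self, zero_smul, zero_add]
        refine Finset.sum_congr rfl fun i hi => ?_
        rw [Function.update_of_ne]
        rintro rfl; exact ha hi
    obtain ⟨f, hf, hfb⟩ := ih v b h1
    by_cases hfa : 0 ≤ f (v a)
    · refine ⟨f, fun i hi => ?_, hfb⟩
      rcases Finset.mem_insert.1 hi with rfl | hi
      · exact hfa
      · exact hf i hi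
    push Not at hfa
    have h2 : ¬ ∃ c : ι → ℝ, (∀ i, 0 ≤ c i) ∧
        b - (f b / f (v a)) • v a = ∑ i ∈ s, c i • (v i - (f (v i) / f (v a)) • v a) := by
      rintro ⟨c, hc, hb⟩
      refine h ⟨Function.update c a (f b / f (v a) + ∑ i ∈ s, c i * (- (f (v i) / f (v a)))), fun i => ?_, ?_⟩
      · by_cases hi : i = a
        · subst hi
          simp only [Function.update_self]
          refine add_nonneg (div_nonneg_of_nonpos hfb.le hfa.le) (Finset.sum_nonneg fun j hj => mul_nonneg (hc j) ?_)
          rw [neg_nonneg]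
          exact div_nonpos_of_nonneg_of_nonpos (hf j hj) hfa.le
        · simp [hi, hc]
      · rw [Finset.sum_insert ha]
        have : ∑ i ∈ s, Function.update c a (f b / f (v a) + ∑ i ∈ s, c i * (- (f (v i) / f (v a)))) i • v i
            = ∑ i ∈ s, c i • v i := by
          refine Finset.sum_congr rfl fun i hi => ?_
          rw [Function.update_of_ne]
          rintro rfl; exact ha hi
        rw [this, Function.update_self]
        rw [sub_eq_iff_eq_add] at hb
        refine hb.trans ?_
        rw [add_smul, Finset.sum_smul]
        simp only [smul_sub, Finset.sum_sub_distrib, smul_smul, mul_neg, neg_smul, Finset.sum_neg_distrib]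
        abel
    obtain ⟨g, hg, hgb⟩ := ih _ _ h2
    refine ⟨g - (g (v a) / f (v a)) • f, fun i hi => ?_, ?_⟩
    · rcases Finset.mem_insert.1 hi with rfl | hi
      · simp [hfa.ne]
      · have := hg i hi
        simp only [map_sub, map_smul, smul_eq_mul, LinearMap.sub_apply, LinearMap.smul_apply] at this ⊢
        convert this using 2; ring
    · simp only [map_sub, map_smul, smul_eq_mul, LinearMap.sub_apply, LinearMap.smul_apply] at hgb ⊢
      convert hgb using 2; ring

theorem ftli {ι : Type*} [Fintype ι] {V : Type*} [AddCommGroup V] [Module ℝ V]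
    (v : ι → V) (b : V) (hbs : b ∈ Submodule.span ℝ (Set.range v))
    (h : ¬ ∃ c : ι → ℝ, (∀ i, 0 ≤ c i) ∧ b = ∑ i, c i • v i) :
    ∃ f : V →ₗ[ℝ] ℝ, (∀ i, 0 ≤ f (v i)) ∧ f b < 0 ∧
      Submodule.span ℝ (Set.range v) ≤ Submodule.span ℝ (insert b (v '' {i | f (v i) = 0})) := by
  classical
  obtain ⟨f0, hf0, hf0b⟩ := farkas_aux Finset.univ v b h
  let P : ℕ → Prop := fun k => ∃ f : V →ₗ[ℝ] ℝ, (∀ i, 0 ≤ f (v i)) ∧ f b < 0 ∧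
    (Finset.univ.filter fun i => f (v i) = 0).card = k
  have hP0 : P (Finset.univ.filter fun i => f0 (v i) = 0).card := 
    ⟨f0, fun i => hf0 i (Finset.mem_univ i), hf0b, rfl⟩
  have hbd : ∀ k, P k → k ≤ Fintype.card ι := by
    rintro k ⟨f, -, -, rfl⟩
    exact Finset.card_le_univ _
  obtain ⟨f, hf, hfb, hk⟩ := Nat.findGreatest_spec (P := P) (hbd _ hP0) hP0
  refine ⟨f, hf, hfb, ?_⟩
  by_contra hcon
  obtain ⟨u, hu, hu'⟩ := SetLike.not_le_iff_exists.1 hcon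
  obtain ⟨g, hgu, hg⟩ := Submodule.exists_le_ker_of_notMem hu'
  have hgb : g b = 0 := hg (Submodule.subset_span (Set.mem_insert _ _))
  have hgz : ∀ i, f (v i) = 0 → g (v i) = 0 := fun i hi =>
    hg (Submodule.subset_span (Set.mem_insert_of_mem _ ⟨i, hi, rfl⟩))
  have hex : ∃ i, g (v i) ≠ 0 := by
    by_contra hall
    push Not at hall
    have : Submodule.span ℝ (Set.range v) ≤ LinearMap.ker g := by
      rw [Submodule.span_le]
      rintro _ ⟨i, rfl⟩
      exact hall i
    exact hgu (this hu)
  obtain ⟨g, hgb, hgz, hex⟩ : ∃ g : V →ₗ[ℝ] ℝ, g b = 0 ∧ (∀ i, f (v i) = 0 → g (v i) = 0) ∧ ∃ i, g (v i) < 0 := by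
    obtain ⟨i, hi⟩ := hex
    rcases lt_or_gt_of_ne hi with hi | hi
    · exact ⟨g, hgb, hgz, i, hi⟩
    · exact ⟨-g, by simp [hgb], fun j hj => by simp [hgz j hj], i, by simpa using hi⟩
  obtain ⟨i0, hi0⟩ := hex
  obtain ⟨m, hm, hmin⟩ := Finset.exists_min_image (Finset.univ.filter fun i => g (v i) < 0)
    (fun i => f (v i) / (- g (v i))) ⟨i0, by simpa using hi0⟩
  have hm : g (v m) < 0 := by simpa using hm
  set t := f (v m) / (- g (v m)) with ht
  have ht0 : 0 ≤ t := div_nonneg (hf m) (by linarith)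
  have hF : ∀ i, 0 ≤ (f + t • g) (v i) := by
    intro i
    simp only [LinearMap.add_apply, LinearMap.smul_apply, smul_eq_mul]
    by_cases hi : g (v i) < 0
    · have := hmin i (by simpa using hi)
      rw [le_div_iff₀ (by linarith)] at this
      linarith
    · push Not at hi
      have := hf i
      positivity
  have hFm : (f + t • g) (v m) = 0 := by
    simp only [LinearMap.add_apply, LinearMap.smul_apply, smul_eq_mul, ht]
    have := hm.ne
    field_simp
    ring
  have hfm : f (v m) ≠ 0 := fun h0 => hm.ne (hgz m h0)
  have hPn : P (Finset.univ.filter fun i => (f + t • g) (v i) = 0).card :=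
    ⟨f + t • g, hF, by simp [hgb, hfb], rfl⟩
  have hle := Nat.le_findGreatest (hbd _ hPn) hPn
  have hlt : (Finset.univ.filter fun i => f (v i) = 0).card <
      (Finset.univ.filter fun i => (f + t • g) (v i) = 0).card := by
    apply Finset.card_lt_card
    refine ⟨?_, ?_⟩
    · intro i hi
      have hi : f (v i) = 0 := by simpa using hi
      simp [hi, hgz i hi]
    · intro hsub
      have := hsub (Finset.mem_filter.2 ⟨Finset.mem_univ m, hFm⟩)
      exact hfm (by simpa using this)
  omega

theorem mem_hull_range {ι : Type*} [Fintype ι] {V : Type*} [AddCommGroup V] [Module ℝ V] (x : ι → V) (p : V) :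
    p ∈ convexHull ℝ (Set.range x) ↔ ∃ w : ι → ℝ, (∀ i, 0 ≤ w i) ∧ ∑ i, w i = 1 ∧ ∑ i, w i • x i = p := by
  classical
  constructor
  · intro hp
    have : convexHull ℝ (Set.range x) ⊆ {p | ∃ w : ι → ℝ, (∀ i, 0 ≤ w i) ∧ ∑ i, w i = 1 ∧ ∑ i, w i • x i = p} := by
      apply convexHull_min
      · rintro _ ⟨i, rfl⟩
        refine ⟨Pi.single i 1, fun j => ?_, by simp, ?_⟩
        · by_cases h : j = i
          · subst h; simp
          · simp [h]
        · simp [Pi.single_apply, ite_smul]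
      · rintro _ ⟨w, hw, hw1, rfl⟩ _ ⟨w', hw', hw1', rfl⟩ a b ha hb hab
        refine ⟨a • w + b • w', fun i => ?_, ?_, ?_⟩
        · have := hw i
          have := hw' i
          simp only [Pi.add_apply, Pi.smul_apply, smul_eq_mul]
          positivity
        · simp [Finset.sum_add_distrib, ← Finset.mul_sum, hw1, hw1', hab]
        · simp [Finset.sum_add_distrib, Finset.smul_sum, add_smul, mul_smul]
    exact this hp
  · rintro ⟨w, hw, hw1, rfl⟩
    exact (convex_convexHull ℝ _).sum_mem (fun i _ => hw i) hw1
      (fun i _ => subset_convexHull ℝ _ ⟨i, rfl⟩)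

theorem extreme_weight {ι : Type*} [Fintype ι] {V : Type*} [AddCommGroup V] [Module ℝ V] (x : ι → V) (F : Set V)
    (hF : IsExtreme ℝ (convexHull ℝ (Set.range x)) F) (w : ι → ℝ) (hw : ∀ i, 0 ≤ w i)
    (hw1 : ∑ i, w i = 1) (hp : ∑ i, w i • x i ∈ F) (i : ι) (hi : 0 < w i) : x i ∈ F := by
  classical
  have hsum : w i + ∑ j ∈ Finset.univ.erase i, w j = 1 := by
    rw [Finset.add_sum_erase _ _ (Finset.mem_univ i), hw1]
  have hsum' : w i • x i + ∑ j ∈ Finset.univ.erase i, w j • x j = ∑ i, w i • x i := by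
    rw [Finset.add_sum_erase _ (fun i => w i • x i) (Finset.mem_univ i)]
  have hnn : 0 ≤ ∑ j ∈ Finset.univ.erase i, w j := Finset.sum_nonneg fun j _ => hw j
  rcases hnn.eq_or_lt with h0 | h0
  · have hz : ∀ j ∈ Finset.univ.erase i, w j = 0 :=
      (Finset.sum_eq_zero_iff_of_nonneg fun j _ => hw j).1 h0.symm
    rw [Finset.sum_eq_zero (fun j hj => by rw [hz j hj, zero_smul])] at hsum'
    have : w i = 1 := by linarith
    rw [this] at hsum'
    simpa [← hsum'] using hp
  · refine hF.left_mem_of_mem_openSegment (subset_convexHull ℝ _ ⟨i, rfl⟩)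
      (y := (Finset.univ.erase i).centerMass w x) ?_ hp ?_
    · exact Finset.centerMass_mem_convexHull _ (fun j _ => hw j) h0 (fun j _ => ⟨j, rfl⟩)
    · refine ⟨w i, ∑ j ∈ Finset.univ.erase i, w j, hi, h0, hsum, ?_⟩
      rw [Finset.centerMass, smul_smul, mul_inv_cancel₀ h0.ne', one_smul, hsum']

theorem face_eq_hull {ι : Type*} [Fintype ι] {V : Type*} [AddCommGroup V] [Module ℝ V] (x : ι → V) (F : Set V)
    (hF : IsExtreme ℝ (convexHull ℝ (Set.range x)) F) (hc : Convex ℝ F) :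
    F = convexHull ℝ (x '' {i | x i ∈ F}) := by
  apply Set.Subset.antisymm
  · intro p hp
    obtain ⟨w, hw, hw1, rfl⟩ := (mem_hull_range x p).1 (hF.subset hp)
    have key : ∀ i, w i ≠ 0 → x i ∈ F := fun i hi =>
      extreme_weight x F hF w hw hw1 hp i (lt_of_le_of_ne (hw i) (Ne.symm hi))
    classical
    rw [← Finset.sum_filter_add_sum_filter_not Finset.univ (fun i => w i ≠ 0)] at hw1 ⊢
    rw [Finset.sum_eq_zero (s := Finset.univ.filter fun i => ¬ w i ≠ 0) (fun i hi => by simpa using hi), add_zero] at hw1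
    rw [Finset.sum_eq_zero (s := Finset.univ.filter fun i => ¬ w i ≠ 0)
      (fun i hi => by 
        have : w i = 0 := by simpa using hi
        rw [this, zero_smul]), add_zero]
    refine (convex_convexHull ℝ _).sum_mem (fun i _ => hw i) hw1 (fun i hi => subset_convexHull ℝ _ ⟨i, key i (by simpa using hi), rfl⟩)
  · apply convexHull_min _ hc
    rintro _ ⟨i, hi, rfl⟩
    exact hi

/-- barycenter -/
theorem exists_bary {ι : Type*} [Fintype ι] {V : Type*} [AddCommGroup V] [Module ℝ V] (x : ι → V) (s : Finset ι)
    (hs : s.Nonempty) : ∃ q ∈ convexHull ℝ (x '' s), ∑ i ∈ s, (x i - q) = 0 := by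
  have hc : (s.card : ℝ) ≠ 0 := by simpa using hs.ne_empty
  refine ⟨∑ i ∈ s, (s.card : ℝ)⁻¹ • x i, ?_, ?_⟩
  · refine (convex_convexHull ℝ _).sum_mem (fun i _ => by positivity) (by simp [hc])
      (fun i hi => subset_convexHull ℝ _ ⟨i, hi, rfl⟩)
  · rw [Finset.sum_sub_distrib, ← Finset.smul_sum, Finset.sum_const, ← Nat.cast_smul_eq_nsmul ℝ, smul_smul, 
      mul_inv_cancel₀ hc, one_smul, sub_self]

theorem pointed {ι : Type*} [Fintype ι] {V : Type*} [AddCommGroup V] [Module ℝ V] (x : ι → V) (F : Set V)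
    (hF : IsExtreme ℝ (convexHull ℝ (Set.range x)) F) (s : Finset ι) (hs : s.Nonempty) (hsF : ∀ i, i ∈ s ↔ x i ∈ F)
    (q : V) (hqF : q ∈ F) (hq : ∑ i ∈ s, (x i - q) = 0) (c : ι → ℝ) (hc : ∀ i, 0 ≤ c i)
    (hmem : ∑ i, c i • (x i - q) ∈ Submodule.span ℝ ((fun y => y - q) '' (x '' s))) :
    ∀ i, i ∉ s → c i = 0 := by
  classical
  have hmem' : ∃ e : ι → ℝ, ∑ i ∈ s, e i • (x i - q) = ∑ i, c i • (x i - q) := by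
    rw [Set.image_image] at hmem
    obtain ⟨e, he⟩ := (Submodule.mem_span_image_finset_iff_exists_fun ℝ).1 hmem
    refine ⟨fun i => if h : i ∈ s then e ⟨i, h⟩ else 0, ?_⟩
    rw [← he, ← Finset.sum_coe_sort s]
    refine Finset.sum_congr rfl fun i _ => ?_
    simp
  obtain ⟨e, he⟩ := hmem'
  obtain ⟨N, hN⟩ : ∃ N : ℝ, ∀ i, e i < N := by
    refine ⟨∑ i, |e i| + 1, fun i => ?_⟩
    have := Finset.single_le_sum (f := fun i => |e i|) (fun i _ => abs_nonneg _) (Finset.mem_univ i)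
    have := le_abs_self (e i)
    linarith
  let w : ι → ℝ := fun i => c i + if i ∈ s then N - e i else 0
  have hw : ∀ i, 0 ≤ w i := fun i => by
    have := hc i
    have := hN i
    simp only [w]
    split_ifs <;> linarith
  have hw0 : ∑ i, w i • (x i - q) = 0 := by
    simp only [w, add_smul, Finset.sum_add_distrib, ite_smul, zero_smul, Finset.sum_ite_mem, Finset.univ_inter,
      sub_smul, Finset.sum_sub_distrib]
    rw [he, ← Finset.smul_sum, hq]
    simp
  have hWpos : 0 < ∑ i, w i := by
    obtain ⟨i, hi⟩ := hs
    refine Finset.sum_pos' (fun i _ => hw i) ⟨i, Finset.mem_univ _, ?_⟩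
    have := hc i
    have := hN i
    simp only [w, hi, if_true]
    linarith
  set W := ∑ i, w i with hW
  intro i hi
  by_contra hci
  apply hi
  rw [hsF]
  refine extreme_weight x F hF (fun i => W⁻¹ * w i) (fun i => mul_nonneg (by positivity) (hw i)) ?_ ?_ i ?_
  · rw [← Finset.mul_sum, ← hW, inv_mul_cancel₀ hWpos.ne']
  · simp only [smul_sub, Finset.sum_sub_distrib, ← Finset.sum_smul] at hw0
    rw [← hW, sub_eq_zero] at hw0
    simp only [mul_smul, ← Finset.smul_sum]
    rw [hw0, smul_smul, inv_mul_cancel₀ hWpos.ne', one_smul]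
    exact hqF
  · have := lt_of_le_of_ne (hc i) (Ne.symm hci)
    simp only [w, hi, if_false, add_zero]
    positivity

def FacetFun {ι : Type*} {V : Type*} [AddCommGroup V] [Module ℝ V] (x : ι → V) (s : Finset ι) (q : V)
    (f : V →ₗ[ℝ] ℝ) : Prop :=
  (∀ i, 0 ≤ f (x i - q)) ∧ (∀ i ∈ s, f (x i - q) = 0) ∧
    ∃ b ∈ Submodule.span ℝ ((fun y => y - q) '' Set.range x), f b < 0 ∧
      Submodule.span ℝ ((fun y => y - q) '' Set.range x) ≤
        Submodule.span ℝ (insert b ((fun y => y - q) '' (x '' {i | f (x i - q) = 0})))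

theorem exists_facetFun_aux {ι : Type*} [Fintype ι] {V : Type*} [AddCommGroup V] [Module ℝ V] (x : ι → V)
    (s : Finset ι) (q : V) (u : V)
    (hu : u ∈ Submodule.span ℝ ((fun y => y - q) '' Set.range x))
    (h : ¬ ∃ a : ι → ℝ, (∀ i, 0 ≤ a i) ∧ u - ∑ i, a i • (x i - q) ∈ Submodule.span ℝ ((fun y => y - q) '' (x '' s))) :
    ∃ f, FacetFun x s q f ∧ f u ≠ 0 := by
  classical
  let w : ι ⊕ ι → V := Sum.elim (fun i => x i - q) (fun i => if i ∈ s then -(x i - q) else 0)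
  have hspan : Submodule.span ℝ ((fun y => y - q) '' Set.range x) ≤ Submodule.span ℝ (Set.range w) := by
    apply Submodule.span_mono
    rintro _ ⟨_, ⟨i, rfl⟩, rfl⟩
    exact ⟨Sum.inl i, rfl⟩
  obtain ⟨f, hf, hfu, hle⟩ := ftli w u (hspan hu) (by
    rintro ⟨c, hc, hcu⟩
    refine h ⟨fun i => c (Sum.inl i), fun i => hc _, ?_⟩
    rw [hcu, Fintype.sum_sum_type]
    simp only [w, Sum.elim_inl, Sum.elim_inr, add_sub_cancel_left]
    refine Submodule.sum_mem _ fun i _ => Submodule.smul_mem _ _ ?_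
    split_ifs with hi
    · exact Submodule.neg_mem _ (Submodule.subset_span ⟨_, ⟨i, hi, rfl⟩, rfl⟩)
    · exact Submodule.zero_mem _)
  have h1 : ∀ i, 0 ≤ f (x i - q) := fun i => hf (Sum.inl i)
  have h2 : ∀ i ∈ s, f (x i - q) = 0 := fun i hi => by
    have := hf (Sum.inr i)
    simp only [w, Sum.elim_inr, hi, if_true, map_neg] at this
    have := h1 i
    linarith
  refine ⟨f, ⟨h1, h2, u, hu, hfu, hspan.trans (hle.trans ?_)⟩, hfu.ne⟩
  rw [Submodule.span_le]
  rintro y (rfl | ⟨i | i, hi, rfl⟩)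
  · exact Submodule.subset_span (Set.mem_insert _ _)
  · exact Submodule.subset_span (Set.mem_insert_of_mem _ ⟨_, ⟨i, hi, rfl⟩, rfl⟩)
  · simp only [w, Sum.elim_inr]
    split_ifs with his
    · exact Submodule.neg_mem _ (Submodule.subset_span (Set.mem_insert_of_mem _ ⟨_, ⟨i, h2 i his, rfl⟩, rfl⟩))
    · exact Submodule.zero_mem _

theorem FacetFun.mem_span {ι : Type*} {V : Type*} [AddCommGroup V] [Module ℝ V] {x : ι → V} {s : Finset ι} {q : V}
    {f : V →ₗ[ℝ] ℝ} (hf : FacetFun x s q f) {u : V}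
    (hu : u ∈ Submodule.span ℝ ((fun y => y - q) '' Set.range x)) (h0 : f u = 0) :
    u ∈ Submodule.span ℝ ((fun y => y - q) '' (x '' {i | f (x i - q) = 0})) := by
  obtain ⟨-, -, b, hb, hfb, hle⟩ := hf
  obtain ⟨a, z, hz, rfl⟩ := Submodule.mem_span_insert.1 (hle hu)
  have hz0 : f z = 0 := by
    have : Submodule.span ℝ ((fun y => y - q) '' (x '' {i | f (x i - q) = 0})) ≤ LinearMap.ker f := by
      rw [Submodule.span_le]
      rintro _ ⟨_, ⟨i, hi, rfl⟩, rfl⟩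
      exact hi
    exact this hz
  simp only [map_add, map_smul, hz0, smul_eq_mul, add_zero, mul_eq_zero, hfb.ne, or_false] at h0
  simpa [h0] using hz

theorem exists_facetFun {ι : Type*} [Fintype ι] {V : Type*} [AddCommGroup V] [Module ℝ V] (x : ι → V) (F : Set V)
    (hF : IsExtreme ℝ (convexHull ℝ (Set.range x)) F) (s : Finset ι) (hs : s.Nonempty) (hsF : ∀ i, i ∈ s ↔ x i ∈ F)
    (q : V) (hqF : q ∈ F) (hq : ∑ i ∈ s, (x i - q) = 0) (u : V)
    (hu : u ∈ Submodule.span ℝ ((fun y => y - q) '' Set.range x))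
    (hu0 : u ∉ Submodule.span ℝ ((fun y => y - q) '' (x '' s))) :
    ∃ f, FacetFun x s q f ∧ f u ≠ 0 := by
  by_cases h1 : ∃ a : ι → ℝ, (∀ i, 0 ≤ a i) ∧ u - ∑ i, a i • (x i - q) ∈ Submodule.span ℝ ((fun y => y - q) '' (x '' s))
  · by_cases h2 : ∃ a : ι → ℝ, (∀ i, 0 ≤ a i) ∧ -u - ∑ i, a i • (x i - q) ∈ Submodule.span ℝ ((fun y => y - q) '' (x '' s))
    · exfalso
      obtain ⟨a, ha, hau⟩ := h1
      obtain ⟨b, hb, hbu⟩ := h2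
      have h3 := pointed x F hF s hs hsF q hqF hq (fun i => a i + b i) (fun i => add_nonneg (ha i) (hb i)) (by
        have := Submodule.neg_mem _ (Submodule.add_mem _ hau hbu)
        convert this using 1
        simp only [add_smul, Finset.sum_add_distrib]
        abel)
      apply hu0
      have h4 : ∑ i, a i • (x i - q) ∈ Submodule.span ℝ ((fun y => y - q) '' (x '' s)) := by
        refine Submodule.sum_mem _ fun i _ => ?_
        by_cases hi : i ∈ s
        · exact Submodule.smul_mem _ _ (Submodule.subset_span ⟨_, ⟨i, hi, rfl⟩, rfl⟩)
        · have := h3 i hi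
          have : a i = 0 := by linarith [ha i, hb i]
          simp [this]
      simpa using Submodule.add_mem _ hau h4
    · obtain ⟨f, hf, hfu⟩ := exists_facetFun_aux x s q (-u) (Submodule.neg_mem _ hu) h2
      exact ⟨f, hf, by simpa using hfu⟩
  · exact exists_facetFun_aux x s q u hu h1

theorem direction_eq {V : Type*} [AddCommGroup V] [Module ℝ V] (S : Set V) (q : V) (hq : q ∈ affineSpan ℝ S) :
    (affineSpan ℝ S).direction = Submodule.span ℝ ((fun y => y - q) '' S) := by
  rw [← affineSpan_insert_eq_affineSpan ℝ hq, direction_affineSpan,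
    vectorSpan_eq_span_vsub_set_right ℝ (Set.mem_insert q S)]
  simp [Set.image_insert_eq]

theorem sdim_hull (S : Set V) (q : V) (hq : q ∈ convexHull ℝ S) :
    sdim (convexHull ℝ S) = Module.finrank ℝ (Submodule.span ℝ ((fun y => y - q) '' S)) := by
  rw [sdim, if_pos ⟨q, hq⟩, affineSpan_convexHull, direction_eq S q (convexHull_subset_affineSpan S hq)]

theorem FacetFun.isFacet {n : ℕ} (d : ℕ) (x : Fin (n+1) → V) (hQ : sdim (braxQ x) = d) (s : Finset (Fin (n+1)))
    (q : V) (hqs : q ∈ convexHull ℝ (x '' s)) (f : V →ₗ[ℝ] ℝ) (hf : FacetFun x s q f) :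
    IsFacetOf d (braxQ x) (convexHull ℝ (x '' {i | f (x i - q) = 0})) := by
  have hq' : q ∈ convexHull ℝ (x '' {i | f (x i - q) = 0}) :=
    convexHull_mono (Set.image_mono fun i hi => hf.2.1 i hi) hqs
  have hqQ : q ∈ braxQ x := convexHull_mono (Set.image_subset_range _ _) hqs
  have hge : ∀ y ∈ braxQ x, f q ≤ f y := by
    intro y hy
    have : braxQ x ⊆ {y | f q ≤ f y} := by
      apply convexHull_min
      · rintro _ ⟨i, rfl⟩
        have := hf.1 i
        simpa using this
      · exact convex_halfSpace_ge f.isLinear _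
    exact this hy
  have hext : IsExtreme ℝ (braxQ x) {y | y ∈ braxQ x ∧ f y = f q} := by
    refine ⟨fun y hy => hy.1, ?_⟩
    rintro y hy z hz _ ⟨-, hw⟩ ⟨a, b, ha, hb, hab, rfl⟩
    refine ⟨hy, ?_⟩
    simp only [map_add, map_smul, smul_eq_mul] at hw
    have h1 := hge y hy
    have h2 := hge z hz
    have hbe : b = 1 - a := by linarith
    subst hbe
    nlinarith
  have hconv : Convex ℝ {y | y ∈ braxQ x ∧ f y = f q} :=
    (convex_convexHull ℝ _).inter (convex_hyperplane f.isLinear _)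
  have heq := face_eq_hull x _ hext hconv
  have hset : {i | x i ∈ {y | y ∈ braxQ x ∧ f y = f q}} = {i | f (x i - q) = 0} := by
    ext i
    have : x i ∈ braxQ x := subset_convexHull ℝ _ ⟨i, rfl⟩
    simp [this, sub_eq_zero]
  rw [hset] at heq
  refine ⟨⟨?_, convex_convexHull ℝ _, ?_⟩, ?_⟩
  · rw [← heq]; exact hext
  · exact (Set.Finite.isCompact_convexHull ℝ (Set.toFinite _)).isClosed
  · rw [sdim_hull _ q hq']
    rw [braxQ, sdim_hull _ q hqQ] at hQ
    have hQ' : Module.finrank ℝ (Submodule.span ℝ ((fun y => y - q) '' Set.range x)) = d := by exact_mod_cast hQ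
    set D := Submodule.span ℝ ((fun y => y - q) '' Set.range x) with hD
    set Z := Submodule.span ℝ ((fun y => y - q) '' (x '' {i | f (x i - q) = 0})) with hZ
    have hZD : Z ≤ D := Submodule.span_mono (Set.image_mono (Set.image_subset_range _ _))
    haveI : FiniteDimensional ℝ D := FiniteDimensional.span_of_finite ℝ (Set.toFinite _)
    haveI : FiniteDimensional ℝ Z := FiniteDimensional.span_of_finite ℝ (Set.toFinite _)
    -- restrict f to D
    let g : D →ₗ[ℝ] ℝ := f.comp D.subtype
    obtain ⟨b, hb, hfb, -⟩ := hf.2.2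
    have hg0 : g ≠ 0 := fun h => hfb.ne (by simpa [g] using LinearMap.congr_fun h ⟨b, hb⟩)
    have hsurj : LinearMap.range g = ⊤ := LinearMap.range_eq_top.2 (LinearMap.surjective hg0)
    have hrn := LinearMap.finrank_range_add_finrank_ker g
    rw [hsurj, finrank_top, Module.finrank_self, hQ'] at hrn
    have hker : Submodule.map D.subtype (LinearMap.ker g) = Z := by
      apply le_antisymm
      · rintro _ ⟨u, hu, rfl⟩
        exact hf.mem_span u.2 hu
      · rw [hZ, Submodule.span_le]
        rintro _ ⟨_, ⟨i, hi, rfl⟩, rfl⟩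
        exact ⟨⟨x i - q, Submodule.subset_span ⟨_, ⟨i, rfl⟩, rfl⟩⟩, hi, rfl⟩
    have : Module.finrank ℝ Z = Module.finrank ℝ (LinearMap.ker g) := by
      rw [← hker]
      exact Submodule.finrank_map_subtype_eq D _
    omega


theorem vertex_mem {n : ℕ} (x : Fin (n+1) → V) (hext : ∀ i, x i ∈ Set.extremePoints ℝ (braxQ x))
    (S : Set V) (hS : S ⊆ Set.range x) (k : Fin (n+1)) (hk : x k ∈ convexHull ℝ S) : x k ∈ S :=
  extremePoints_convexHull_subset (𝕜 := ℝ)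
    (inter_extremePoints_subset_extremePoints_of_subset (convexHull_mono hS) ⟨hk, hext k⟩)

theorem Tset_eq (d : ℕ) {n : ℕ} (x : Fin (n+1) → V) (i : ℤ) (hi : 0 ≤ i) (hin : i ≤ (n:ℤ) - d + 1) :
    Tset d x i = x '' {k | i ≤ (k : ℤ) ∧ (k : ℤ) ≤ i + d - 1} := by
  ext y
  constructor
  · rintro ⟨t, ⟨h1, h2⟩, rfl⟩
    refine ⟨_, ?_, rfl⟩
    simp only [Set.mem_setOf_eq]
    omega
  · rintro ⟨k, ⟨h1, h2⟩, rfl⟩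
    refine ⟨k, ⟨h1, h2⟩, ?_⟩
    unfold xc
    congr 1
    ext
    have := k.2
    simp only
    omega

theorem Eset_subset (d : ℕ) {n : ℕ} (x : Fin (n+1) → V) (j : ℤ) : Eset d x j ⊆ Set.range x := by
  rintro y (rfl | ⟨t, -, rfl⟩)
  · exact ⟨_, rfl⟩
  · exact ⟨_, rfl⟩

theorem mem_Eset (d : ℕ) (hd : 3 ≤ d) {n : ℕ} (x : Fin (n+1) → V) (hinj : Function.Injective x) (j : ℤ)
    (hj : 2 ≤ j) (hjn : j ≤ n) (k : Fin (n+1)) (hk0 : k ≠ 0) (hk : x k ∈ Eset d x j) :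
    j - ((d:ℤ) - 2) ≤ k ∧ (k:ℤ) ≤ j + ((d:ℤ)-2) := by
  have hk0' : (k : ℕ) ≠ 0 := fun h => hk0 (Fin.ext h)
  rcases hk with hk | ⟨t, ⟨⟨h1, h2⟩, -⟩, ht⟩
  · exact absurd (hinj hk) hk0
  · have := congrArg Fin.val (hinj ht)
    simp only at this
    omega

theorem affineIndep_T (d : ℕ) (hd : 3 ≤ d) {n : ℕ} (x : Fin (n+1) → V) (hinj : Function.Injective x)
    (hext : ∀ i, x i ∈ Set.extremePoints ℝ (braxQ x)) (i : ℤ) (hi : 0 ≤ i) (hin : i ≤ (n:ℤ) - d + 1)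
    (hfac : IsFacetOf d (braxQ x) (convexHull ℝ (Tset d x i))) :
    AffineIndependent ℝ (fun k : {k : Fin (n+1) // k = 0 ∨ (i ≤ (k : ℤ) ∧ (k : ℤ) ≤ i + d - 1)} => x k) := by
  classical
  obtain ⟨i, rfl⟩ := Int.eq_ofNat_of_zero_le hi
  rw [Tset_eq d x i hi hin] at hfac
  let t : Finset (Fin (n+1)) := Finset.Icc ⟨i, by omega⟩ ⟨i + d - 1, by omega⟩
  have ht : ∀ k : Fin (n+1), k ∈ t ↔ ((i:ℤ) ≤ (k : ℤ) ∧ (k : ℤ) ≤ i + d - 1) := by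
    intro k
    simp only [t, Finset.mem_Icc, Fin.le_def]
    omega
  have htc : t.card = d := by
    simp only [t, Fin.card_Icc]; omega
  have hts : {k : Fin (n+1) | (i:ℤ) ≤ (k : ℤ) ∧ (k : ℤ) ≤ i + d - 1} = (t : Set (Fin (n+1))) := by
    ext k; simp [ht]
  rw [hts] at hfac
  have htne : t.Nonempty := by rw [← Finset.card_pos]; omega
  have hta : AffineIndependent ℝ (fun k : t => x k) := by
    rw [affineIndependent_iff_finrank_vectorSpan_eq ℝ _ (n := d - 1) (by rw [Fintype.card_coe]; omega)]
    have h := hfac.2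
    have hr : Set.range (fun k : t => x k) = x '' (t : Set (Fin (n+1))) := by
      ext y; simp
    rw [hr, ← direction_affineSpan]
    rw [sdim, if_pos (by simpa using htne), affineSpan_convexHull] at h
    omega
  by_cases h0 : (0 : Fin (n+1)) ∈ t
  · let e : {k : Fin (n+1) // k = 0 ∨ ((i:ℤ) ≤ (k : ℤ) ∧ (k : ℤ) ≤ i + d - 1)} ↪ t :=
      ⟨fun k => ⟨k.1, by
        rcases k.2 with h | h
        · rw [h]; exact h0
        · exact (ht _).2 h⟩, fun a b hab => by simpa [Subtype.ext_iff] using hab⟩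
    exact hta.comp_embedding e
  · refine AffineIndependent.affineIndependent_of_notMem_span (i := ⟨0, Or.inl rfl⟩) ?_ ?_
    · let e : {y : {k : Fin (n+1) // k = 0 ∨ ((i:ℤ) ≤ (k : ℤ) ∧ (k : ℤ) ≤ i + d - 1)} // y ≠ ⟨0, Or.inl rfl⟩} ↪ t :=
        ⟨fun k => ⟨k.1.1, by
          rcases k.1.2 with h | h
          · exact absurd (Subtype.ext h) k.2
          · exact (ht _).2 h⟩, fun a b hab => by simpa [Subtype.ext_iff] using hab⟩
      exact hta.comp_embedding e
    · intro hmem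
      apply h0
      have hmem' : x 0 ∈ affineSpan ℝ (x '' (t : Set (Fin (n+1)))) := by
        refine affineSpan_mono ℝ ?_ hmem
        rintro _ ⟨k, hk, rfl⟩
        refine ⟨k.1, ?_, rfl⟩
        rcases k.2 with h | h
        · exact absurd (Subtype.ext h) hk
        · exact (ht _).2 h
      obtain ⟨q, hq, hqs⟩ := exists_bary x t htne
      have hq' := convexHull_subset_affineSpan _ hq
      by_contra h0
      have := pointed x _ hfac.1.1 t htne (fun k => ⟨fun hk => subset_convexHull ℝ _ ⟨k, hk, rfl⟩, fun hk => by
        obtain ⟨k', hk', he⟩ := vertex_mem x hext _ (Set.image_subset_range _ _) k hk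
        rw [← hinj he]; exact hk'⟩) q hq hqs (Pi.single 0 1) (fun k => by
          by_cases h : k = 0
          · subst h; simp
          · simp [h]) (by
          rw [← direction_eq _ q hq']
          simpa [Pi.single_apply, ite_smul] using AffineSubspace.vsub_mem_direction hmem' hq') 0 h0
      simp at this

theorem finish {n : ℕ} (x : Fin (n+1) → V) (s : Finset (Fin (n+1))) (hs : s.Nonempty)
    (hai : AffineIndependent ℝ (fun k : s => x k)) (hdim : sdim (convexHull ℝ (x '' (s : Set (Fin (n+1))))) = 2) :
    ∃ a b c : V, AffineIndependent ℝ ![a, b, c] ∧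
        convexHull ℝ (x '' (s : Set (Fin (n+1)))) = convexHull ℝ {a, b, c} := by
  classical
  have hc : s.card = 3 := by
    have hpos := hs.card_pos
    have h1 := hai.finrank_vectorSpan (n := s.card - 1) (by rw [Fintype.card_coe]; omega)
    have hr : Set.range (fun k : s => x k) = x '' (s : Set (Fin (n+1))) := by
      ext y; simp
    rw [hr, ← direction_affineSpan] at h1
    rw [sdim, if_pos (by simpa using hs), affineSpan_convexHull] at hdim
    omega
  obtain ⟨a, b, c, hab, hac, hbc, rfl⟩ := Finset.card_eq_three.1 hc
  refine ⟨x a, x b, x c, ?_, ?_⟩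
  · let e : Fin 3 ↪ ({a, b, c} : Finset (Fin (n+1))) := ⟨![⟨a, by simp⟩, ⟨b, by simp⟩, ⟨c, by simp⟩], by
      intro i j hij
      fin_cases i <;> fin_cases j <;> simp_all [Subtype.ext_iff]⟩
    have := hai.comp_embedding e
    convert this using 1
    funext i
    fin_cases i <;> rfl
  · congr 1
    simp [Set.image_insert_eq]

/-- Every 2-dimensional face of a `d`-braxtope is a triangle. -/
theorem braxtope_two_faces_triangles (d n : ℕ) (hd : 3 ≤ d) (hn : d ≤ n)
    (x : Fin (n + 1) → V) (hx : IsBraxtope d n x) :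
    ∀ F : Set V, IsFaceOf (braxQ x) F → sdim F = 2 →
      ∃ a b c : V, AffineIndependent ℝ ![a, b, c] ∧
        F = convexHull ℝ {a, b, c} := by
  classical
  obtain ⟨-, hinj, hQ, hext, hfac⟩ := hx.2 hd
  intro F hF hdim
  have hFne : F.Nonempty := by
    by_contra h
    rw [sdim, if_neg h] at hdim
    omega
  let s : Finset (Fin (n+1)) := Finset.univ.filter fun i => x i ∈ F
  have hsF : ∀ i, i ∈ s ↔ x i ∈ F := fun i => by simp [s]
  have hss : {i | x i ∈ F} = (s : Set (Fin (n+1))) :=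
    Set.ext fun i => (hsF i).symm
  have hFs : F = convexHull ℝ (x '' (s : Set (Fin (n+1)))) := by
    rw [← hss]; exact face_eq_hull x F hF.1 hF.2.1
  have hsne : s.Nonempty := by
    rw [hFs] at hFne
    simpa using hFne
  by_cases hT : ∃ i : ℤ, 0 ≤ i ∧ i ≤ (n:ℤ) - d + 1 ∧ ∀ k ∈ s, k = 0 ∨ (i ≤ (k : ℤ) ∧ (k : ℤ) ≤ i + d - 1)
  · obtain ⟨i, hi, hin, hk⟩ := hT
    have hai := affineIndep_T d hd x hinj hext i hi hin ((hfac _).2 (Or.inl ⟨i, hi, hin, rfl⟩))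
    rw [hFs] at hdim ⊢
    refine finish x s hsne ?_ hdim
    let e : s ↪ {k : Fin (n+1) // k = 0 ∨ (i ≤ (k : ℤ) ∧ (k : ℤ) ≤ i + d - 1)} :=
      ⟨fun k => ⟨k.1, hk k.1 k.2⟩, fun a b hab => Subtype.ext (congrArg (fun z => z.1) hab)⟩
    exact hai.comp_embedding e
  exfalso
  -- two far apart vertices
  obtain ⟨a, ha, ha0, b, hb, hb0, hab⟩ : ∃ a ∈ s, a ≠ 0 ∧ ∃ b ∈ s, b ≠ 0 ∧ (a : ℤ) + d ≤ b := by
    by_cases hne : (s.erase 0).Nonempty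
    · obtain ⟨a, ha, hmin⟩ := Finset.exists_min_image (s.erase 0) id hne
      obtain ⟨b, hb, hmax⟩ := Finset.exists_max_image (s.erase 0) id hne
      refine ⟨a, Finset.mem_of_mem_erase ha, Finset.ne_of_mem_erase ha, b, Finset.mem_of_mem_erase hb,
        Finset.ne_of_mem_erase hb, ?_⟩
      by_contra hlt
      refine hT ⟨min (a:ℤ) ((n:ℤ) - d + 1), by omega, by omega, fun k hk => ?_⟩
      by_cases hk0 : k = 0
      · exact Or.inl hk0
      right
      have h1 := hmin k (Finset.mem_erase.2 ⟨hk0, hk⟩)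
      have h2 := hmax k (Finset.mem_erase.2 ⟨hk0, hk⟩)
      simp only [id, Fin.le_def] at h1 h2
      omega
    · refine absurd ⟨0, le_rfl, by omega, fun k hk => ?_⟩ hT
      left
      by_contra hk0
      exact hne ⟨k, Finset.mem_erase.2 ⟨hk0, hk⟩⟩
  obtain ⟨q, hqs, hq⟩ := exists_bary x s hsne
  have hqF : q ∈ F := by rw [hFs]; exact hqs
  let K : Finset ℤ := Finset.Icc ((b:ℤ) - (d - 2)) (a + (d - 2))
  have hK : K.card + 3 ≤ d := by
    simp only [K, Int.card_Icc]
    omega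
  -- every facet functional comes from some `j ∈ K`
  have hfK : ∀ f, FacetFun x s q f → ∃ j ∈ K,
      convexHull ℝ (x '' {i | f (x i - q) = 0}) = convexHull ℝ (Eset d x j) := by
    intro f hf
    have hmem : ∀ k ∈ s, x k ∈ convexHull ℝ (x '' {i | f (x i - q) = 0}) := fun k hk =>
      subset_convexHull ℝ _ ⟨k, hf.2.1 k hk, rfl⟩
    rcases (hfac _).1 (hf.isFacet d x hQ s q hqs f) with ⟨i, hi, hin, he⟩ | ⟨j, hj, hjn, he⟩
    · exfalso
      rw [he, Tset_eq d x i hi hin] at hmem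
      obtain ⟨a', ⟨h1, h2⟩, ha'⟩ := vertex_mem x hext _ (Set.image_subset_range _ _) a (hmem a ha)
      obtain ⟨b', ⟨h3, h4⟩, hb'⟩ := vertex_mem x hext _ (Set.image_subset_range _ _) b (hmem b hb)
      rw [hinj ha'] at h1 h2
      rw [hinj hb'] at h3 h4
      omega
    · refine ⟨j, ?_, he⟩
      rw [he] at hmem
      have h1 := mem_Eset d hd x hinj j hj hjn a ha0 (vertex_mem x hext _ (Eset_subset d x j) a (hmem a ha))
      have h2 := mem_Eset d hd x hinj j hj hjn b hb0 (vertex_mem x hext _ (Eset_subset d x j) b (hmem b hb))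
      simp only [K, Finset.mem_Icc]
      omega
  set D := Submodule.span ℝ ((fun y => y - q) '' Set.range x) with hD
  have hchoice : ∀ j : ℤ, ∃ g : V →ₗ[ℝ] ℝ, ∀ f, FacetFun x s q f →
      convexHull ℝ (x '' {i | f (x i - q) = 0}) = convexHull ℝ (Eset d x j) → ∀ u ∈ D, g u = 0 → f u = 0 := by
    intro j
    by_cases hex : ∃ g, FacetFun x s q g ∧
      convexHull ℝ (x '' {i | g (x i - q) = 0}) = convexHull ℝ (Eset d x j)
    · obtain ⟨g, hg, hgE⟩ := hex
      refine ⟨g, fun f hf hfE u hu hgu => ?_⟩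
      have h1 := hg.mem_span hu hgu
      have h2 : Submodule.span ℝ ((fun y => y - q) '' (x '' {i | g (x i - q) = 0})) ≤ LinearMap.ker f := by
        rw [Submodule.span_le]
        rintro _ ⟨_, ⟨i, hi, rfl⟩, rfl⟩
        have h3 : x i ∈ convexHull ℝ (x '' {i | f (x i - q) = 0}) := by
          rw [hfE, ← hgE]
          exact subset_convexHull ℝ _ ⟨i, hi, rfl⟩
        obtain ⟨i', hi', he⟩ := vertex_mem x hext _ (Set.image_subset_range _ _) i h3
        rw [hinj he] at hi'
        exact hi'
      exact h2 h1
    · exact ⟨0, fun f hf hfE => absurd ⟨f, hf, hfE⟩ hex⟩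
  choose g hg using hchoice
  have : FiniteDimensional ℝ D := FiniteDimensional.span_of_finite ℝ (Set.toFinite _)
  let L : D →ₗ[ℝ] (K → ℝ) := LinearMap.pi fun j => (g j).comp D.subtype
  have hrn := LinearMap.finrank_range_add_finrank_ker L
  have hDd : Module.finrank ℝ D = d := by
    rw [braxQ, sdim_hull _ q (convexHull_mono (Set.image_subset_range _ _) hqs)] at hQ
    exact_mod_cast hQ
  have hr : Module.finrank ℝ (LinearMap.range L) ≤ K.card := by
    refine (Submodule.finrank_le _).trans ?_
    simp
  have hU : Module.finrank ℝ (Submodule.span ℝ ((fun y => y - q) '' (x '' (s : Set (Fin (n+1)))))) = 2 := by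
    rw [hFs, sdim_hull _ q hqs] at hdim
    exact_mod_cast hdim
  have hnle : ¬ Submodule.map D.subtype (LinearMap.ker L) ≤
      Submodule.span ℝ ((fun y => y - q) '' (x '' (s : Set (Fin (n+1))))) := by
    intro hle
    have : FiniteDimensional ℝ (Submodule.span ℝ ((fun y => y - q) '' (x '' (s : Set (Fin (n+1)))))) :=
      FiniteDimensional.span_of_finite ℝ (Set.toFinite _)
    have h1 := Submodule.finrank_mono hle
    rw [Submodule.finrank_map_subtype_eq] at h1
    omega
  obtain ⟨_, ⟨u, hu, rfl⟩, hu'⟩ := SetLike.not_le_iff_exists.1 hnle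
  obtain ⟨f, hf, hfu⟩ := exists_facetFun x F hF.1 s hsne hsF q hqF hq u.1 u.2 hu'
  obtain ⟨j, hj, hE⟩ := hfK f hf
  exact hfu (hg j f hf hE u.1 u.2 (congrFun (show L u = 0 from hu) ⟨j, hj⟩))
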